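/- Let σ be an intertwining permutation (n,s,L) → (n,t,M) and let j ∈ {1,…,n−1} ∖ L. Let (n−1, s′, L′) and (n−1, t′, M′) be the edge contractions of (n,s,L) at j and of (n,t,M) at σ(j), respectively. Then there is a unique map σ′ : {1,…,n−1} → {1,…,n−1} satisfying τ_{t,σ(j)} ∘ σ′ = σ ∘ τ_{s,j}; this σ′ is a permutation and it is an intertwining permutation (n−1, s′, L′) → (n−1, t′, M′). -/

import Mathlib

def IsTree (n : ℕ) (s : ℕ → ℕ) (L : Finset ℕ) : Prop :=
  L ⊆ Finset.Icc 1 n ∧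
  (∀ x ∈ Finset.Icc 1 (n - 1), s x ∈ Finset.Icc 1 n ∧ s x ∉ L) ∧
  (∀ x ∈ Finset.Icc 1 (n - 1), x < s x) ∧
  (∀ x y, x ∈ Finset.Icc 1 (n - 1) → y ∈ Finset.Icc 1 (n - 1) →
    x ≤ y → y < s x → s y ≤ s x)


/-- `σ` is an intertwining permutation `(n,s,L) → (n,t,M)`: a bijection of
`{1,…,n}` (encoded as a permutation of `ℕ` mapping `{1,…,n}` onto itself)
with `σ n = n`, `σ(L) = M`, and `t (σ i) = σ (s i)` on the domain. -/
def Intertwines (n : ℕ) (s : ℕ → ℕ) (L : Finset ℕ) (t : ℕ → ℕ) (M : Finset ℕ)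
    (σ : Equiv.Perm ℕ) : Prop :=
  Set.MapsTo σ (Set.Icc 1 n) (Set.Icc 1 n) ∧
  Set.MapsTo σ.symm (Set.Icc 1 n) (Set.Icc 1 n) ∧
  σ n = n ∧
  L.image σ = M ∧
  ∀ i ∈ Finset.Icc 1 (n - 1), t (σ i) = σ (s i)


/-- The map `τ_{s,j} : {1,…,n-1} → {1,…,n}`, `k ↦ k` for `k < j` and
`k ↦ k+1` for `k ≥ j`; its image is `{1,…,n} ∖ {j}`. -/
def tau (j : ℕ) (x : ℕ) : ℕ := if x < j then x else x + 1

/-- `(n-1, s', L')` is the edge contraction of the tree `(n, s, L)` at `j`: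
`L' = τ_{s,j}⁻¹(L)` and `τ_{s,j}(s' k) = s (τ_{s,j} k)` if `s (τ_{s,j} k) ≠ j`,
while `τ_{s,j}(s' k) = s j` if `s (τ_{s,j} k) = j`. -/
def IsEdgeContraction (n : ℕ) (s : ℕ → ℕ) (L : Finset ℕ) (j : ℕ)
    (s' : ℕ → ℕ) (L' : Finset ℕ) : Prop :=
  IsTree (n - 1) s' L' ∧
  L' = (Finset.Icc 1 (n - 1)).filter (fun x => tau j x ∈ L) ∧
  ∀ x ∈ Finset.Icc 1 (n - 2),
    (s (tau j x) ≠ j → tau j (s' x) = s (tau j x)) ∧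
    (s (tau j x) = j → tau j (s' x) = s j)


theorem tau_injective (j : ℕ) : Function.Injective (tau j) := by
  intro x y h
  unfold tau at h
  split_ifs at h <;> omega

theorem tau_ne (j x : ℕ) : tau j x ≠ j := by
  unfold tau
  split_ifs <;> omega

theorem tau_mem_Icc_iff {n j : ℕ} (hj : j ∈ Set.Icc 1 (n - 1)) (x : ℕ) :
    tau j x ∈ Set.Icc 1 n ↔ x ∈ Set.Icc 1 (n - 1) := by
  simp only [Set.mem_Icc, tau] at *
  split_ifs <;> omega

/-- The left inverse of `tau j` that skips the missing value `j`. -/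
def untau (j : ℕ) (y : ℕ) : ℕ := if y < j then y else y - 1

theorem tau_untau {j y : ℕ} (h : y ≠ j) : tau j (untau j y) = y := by
  unfold tau untau
  split_ifs <;> omega

theorem untau_tau (j x : ℕ) : untau j (tau j x) = x :=
  tau_injective j (tau_untau (tau_ne j x))

/-- The permutation of `ℕ` obtained from `σ` by deleting `j` from the source and `σ j` from the
target and relabelling. -/
def contractPerm (σ : Equiv.Perm ℕ) (j : ℕ) : Equiv.Perm ℕ where
  toFun x := untau (σ j) (σ (tau j x))
  invFun y := untau j (σ.symm (tau (σ j) y))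
  left_inv x := by
    beta_reduce
    rw [tau_untau (σ.injective.ne (tau_ne j x)), σ.symm_apply_apply, untau_tau]
  right_inv y := by
    beta_reduce
    rw [tau_untau, σ.apply_symm_apply, untau_tau]
    rw [Ne, Equiv.symm_apply_eq]
    exact tau_ne (σ j) y

theorem tau_contractPerm (σ : Equiv.Perm ℕ) (j x : ℕ) :
    tau (σ j) (contractPerm σ j x) = σ (tau j x) :=
  tau_untau (σ.injective.ne (tau_ne j x))

theorem tau_contractPerm_symm (σ : Equiv.Perm ℕ) (j y : ℕ) :
    tau j ((contractPerm σ j).symm y) = σ.symm (tau (σ j) y) := by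
  rw [Equiv.eq_symm_apply, ← tau_contractPerm, Equiv.apply_symm_apply]


theorem statement5 (n : ℕ) (s t : ℕ → ℕ) (L M : Finset ℕ) (σ : Equiv.Perm ℕ)
    (hs : IsTree n s L) (ht : IsTree n t M)
    (hσ : Intertwines n s L t M σ)
    (j : ℕ) (hj : j ∈ Finset.Icc 1 (n - 1)) (hjL : j ∉ L)
    (s' : ℕ → ℕ) (L' : Finset ℕ) (t' : ℕ → ℕ) (M' : Finset ℕ)
    (hs' : IsEdgeContraction n s L j s' L')
    (ht' : IsEdgeContraction n t M (σ j) t' M') :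
    (∀ f g : ℕ → ℕ,
      (∀ x ∈ Set.Icc 1 (n - 1), tau (σ j) (f x) = σ (tau j x)) →
      (∀ x ∈ Set.Icc 1 (n - 1), tau (σ j) (g x) = σ (tau j x)) →
      Set.EqOn f g (Set.Icc 1 (n - 1))) ∧
    ∃ σ' : Equiv.Perm ℕ,
      (∀ x ∈ Set.Icc 1 (n - 1), tau (σ j) (σ' x) = σ (tau j x)) ∧
      Intertwines (n - 1) s' L' t' M' σ' := by
  obtain ⟨hmaps, hmaps_symm, hn, hLM, hst⟩ := hσ
  obtain ⟨-, hL', hs'⟩ := hs'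
  obtain ⟨-, hM', ht'⟩ := ht'
  have hj' : j ∈ Set.Icc 1 (n - 1) := by simpa using hj
  have hjn : 1 ≤ j ∧ j ≤ n - 1 := hj'
  have hσj : σ j ∈ Set.Icc 1 (n - 1) := by
    have h : 1 ≤ σ j ∧ σ j ≤ n := hmaps ⟨hjn.1, by omega⟩
    have hne : σ j ≠ n := fun h => by
      have := σ.injective (h.trans hn.symm)
      omega
    exact ⟨h.1, by omega⟩
  have tau_last {k : ℕ} (hk : k ∈ Set.Icc 1 (n - 1)) : tau k (n - 1) = n := by
    have : 1 ≤ k ∧ k ≤ n - 1 := hk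
    unfold tau
    split_ifs <;> omega
  have hmaps' : Set.MapsTo (contractPerm σ j) (Set.Icc 1 (n - 1)) (Set.Icc 1 (n - 1)) := by
    intro x hx
    rw [← tau_mem_Icc_iff hσj, tau_contractPerm]
    exact hmaps ((tau_mem_Icc_iff hj' x).2 hx)
  have hmaps_symm' :
      Set.MapsTo (contractPerm σ j).symm (Set.Icc 1 (n - 1)) (Set.Icc 1 (n - 1)) := by
    intro y hy
    rw [← tau_mem_Icc_iff hj', tau_contractPerm_symm]
    exact hmaps_symm ((tau_mem_Icc_iff hσj y).2 hy)
  have hlast : contractPerm σ j (n - 1) = n - 1 := by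
    apply tau_injective (σ j)
    rw [tau_contractPerm, tau_last hj', tau_last hσj, hn]
  refine ⟨fun f g hf hg x hx => tau_injective _ ((hf x hx).trans (hg x hx).symm),
    contractPerm σ j, fun x _ => tau_contractPerm σ j x, hmaps', hmaps_symm', hlast, ?_, ?_⟩
  · ext y
    have hmem : y ∈ Set.Icc 1 (n - 1) ↔ (contractPerm σ j).symm y ∈ Set.Icc 1 (n - 1) :=
      ⟨fun h => hmaps_symm' h, fun h => by simpa using hmaps' h⟩
    have himage {τ : Equiv.Perm ℕ} {A : Finset ℕ} {z : ℕ} : z ∈ A.image τ ↔ τ.symm z ∈ A := by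
      simp [← Equiv.eq_symm_apply]
    rw [himage, hL', hM', ← hLM]
    simp only [Finset.mem_filter, himage, tau_contractPerm_symm]
    rw [← Finset.mem_coe, ← Finset.mem_coe (a := y), Finset.coe_Icc, hmem]
  · intro i hi
    have hi' : 1 ≤ i ∧ i ≤ n - 1 - 1 := Finset.mem_Icc.1 hi
    have hσi : contractPerm σ j i ∈ Finset.Icc 1 (n - 2) := by
      have h : 1 ≤ contractPerm σ j i ∧ contractPerm σ j i ≤ n - 1 :=
        hmaps' ⟨hi'.1, by omega⟩
      have hne : contractPerm σ j i ≠ n - 1 := fun h => by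
        have := (contractPerm σ j).injective (h.trans hlast.symm)
        omega
      exact Finset.mem_Icc.2 ⟨h.1, by omega⟩
    have htau : tau j i ∈ Finset.Icc 1 (n - 1) := by
      rw [Finset.mem_Icc]
      unfold tau
      split_ifs <;> omega
    have ht'i := ht' _ hσi
    rw [tau_contractPerm, hst _ htau, hst j hj] at ht'i
    apply tau_injective (σ j)
    rw [tau_contractPerm]
    by_cases h : s (tau j i) = j
    · rw [ht'i.2 (congrArg σ h), (hs' i hi).2 h]
    · rw [ht'i.1 (σ.injective.ne h), (hs' i hi).1 h]
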